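/- arXiv:1104.1481 — 2 statements merged into one kernel-verified Lean document; each statement's English description precedes it below -/
import Mathlib

section
/- For integers q ≥ 2 and n ≥ 1, the complexity of the nonbinary hypercube satisfies c(C_q(n)) = n! · ∏_{k=1}^{n} ∏_{l=max(0,2k−n)}^{k} ( ∏_{j=k}^{n+l−k} (qj − (q−1)l) )^{e(k,l)}, where e(k,l) = (q−2)^l · C(n,l) · ( C(n−l, k−l) − C(n−l, k−l−1) ) and C(·,·) denotes the binomial coefficient (with C(m,−1) = 0, and 0^0 = 1). -/
/-- The support of a `q`-ary `n`-tuple: the set of coordinates where it is nonzero. -/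
def supp {n q : ℕ} (a : Fin n → Fin q) : Finset (Fin n) :=
  Finset.univ.filter (fun i => (a i : ℕ) ≠ 0)

/-- The (one-sided) adjacency relation of the nonbinary hypercube. -/
def cubeAdjRel {n q : ℕ} (a b : Fin n → Fin q) : Prop :=
  (supp a ⊆ supp b ∨ supp b ⊆ supp a) ∧
    ((supp a).card + 1 = (supp b).card ∨ (supp b).card + 1 = (supp a).card) ∧
    ∀ i ∈ supp a ∩ supp b, a i = b i

/-- The nonbinary hypercube `C_q(n)`. -/
def nonbinaryCube (n q : ℕ) : SimpleGraph (Fin n → Fin q) :=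
  SimpleGraph.fromRel cubeAdjRel

/-- The number of spanning trees of a graph. -/
noncomputable def complexity {V : Type*} (G : SimpleGraph V) : ℕ :=
  Set.ncard {t : Finset (Sym2 V) | (t : Set (Sym2 V)) ⊆ G.edgeSet ∧ (SimpleGraph.fromEdgeSet (t : Set (Sym2 V))).IsTree}

/-- `C(m, r) - C(m, r-1)`, with the convention `C(m, -1) = 0`. -/
def chooseDiff (m r : ℕ) : ℕ :=
  m.choose r - if r = 0 then 0 else m.choose (r - 1)

/-- The relation "`w` is the parent of `v`" of a partial function `f` is well-founded. -/
def IsRootedForest {V : Type*} (f : V → Option V) : Prop :=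
  WellFounded fun w v => f v = some w

/-- Rows `e_v - e_{f v}`, where `e_none = 0`. -/
def parentMatrix {V : Type*} [DecidableEq V] (R : Type*) [CommRing R] (f : V → Option V) :
    Matrix V V R :=
  fun v w => (if v = w then 1 else 0) - (if f v = some w then 1 else 0)

theorem det_parentMatrix_of_isRootedForest {V : Type*} [Fintype V] [DecidableEq V] (R : Type*)
    [CommRing R] {f : V → Option V} (hf : IsRootedForest f) : (parentMatrix R f).det = 1 := by
  classical
  have : IsWellFounded V (fun w v => f v = some w) := ⟨hf⟩
  let b : V → Ordinalᵒᵈ := fun v =>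
    OrderDual.toDual (IsWellFounded.rank (fun w v => f v = some w) v)
  have hlt : ∀ v w, f v = some w → b v < b w := fun v w h =>
    OrderDual.toDual_lt_toDual.2 (IsWellFounded.rank_lt_of_rel (r := fun w v => f v = some w) h)
  have htri : (parentMatrix R f).BlockTriangular b := by
    intro v w hvw
    have h1 : v ≠ w := by rintro rfl; exact lt_irrefl _ hvw
    have h2 : f v ≠ some w := fun h => lt_asymm hvw (hlt v w h)
    simp [parentMatrix, h1, h2]
  rw [htri.det]
  refine Finset.prod_eq_one fun c _ => ?_
  have : (parentMatrix R f).toSquareBlock b c = 1 := by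
    ext ⟨v, hv⟩ ⟨w, hw⟩
    have h2 : f v ≠ some w := fun h => (hlt v w h).ne (hv.trans hw.symm)
    simp [Matrix.toSquareBlock_def, parentMatrix, h2, Matrix.one_apply]
  rw [this, Matrix.det_one]

theorem det_parentMatrix_of_not_isRootedForest {V : Type*} [Fintype V] [DecidableEq V] (R : Type*)
    [CommRing R] [IsDomain R] {f : V → Option V} (hf : ¬ IsRootedForest f) :
    (parentMatrix R f).det = 0 := by
  classical
  rw [← Matrix.exists_mulVec_eq_zero_iff]
  set r : V → V → Prop := fun w v => f v = some w with hr
  obtain ⟨v₀, hv₀⟩ : ∃ v, ¬ Acc r v := by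
    by_contra! h
    exact hf ⟨h⟩
  refine ⟨fun v => if Acc r v then 0 else 1, fun h => ?_, ?_⟩
  · simpa [hv₀] using congrFun h v₀
  · funext v
    simp only [Matrix.mulVec, dotProduct, parentMatrix, sub_mul, ite_mul, one_mul, zero_mul,
      Finset.sum_sub_distrib, Finset.sum_ite_eq, Finset.mem_univ, if_true, Pi.zero_apply]
    cases hfv : f v with
    | none =>
      have : Acc r v := Acc.intro _ fun w hw => by simp [hr, hfv] at hw
      simp [this]
    | some w =>
      have : Acc r v ↔ Acc r w :=
        ⟨fun h => h.inv hfv, fun h => Acc.intro _ fun u hu => by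
          have : w = u := by simpa [hr, hfv] using hu
          exact this ▸ h⟩
      simp [this]

/-- The parent maps of the rooted spanning forests of `G`. -/
noncomputable def rootedForests {V : Type*} [Fintype V] [DecidableEq V] (G : SimpleGraph V) :
    Finset (V → Option V) :=
  open Classical in
  Finset.univ.filter fun f => IsRootedForest f ∧ ∀ v w, f v = some w → G.Adj v w

/-- The forest form of the matrix-tree theorem: `det (x + L)` enumerates rooted
spanning forests by the number of roots. -/
theorem det_smul_one_add_lapMatrix {V : Type*} [Fintype V] [DecidableEq V] (G : SimpleGraph V)
    [DecidableRel G.Adj] {R : Type*} [CommRing R] [IsDomain R] (x : R) :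
    (x • (1 : Matrix V V R) + G.lapMatrix R).det =
      ∑ f ∈ rootedForests G, x ^ (Finset.univ.filter fun v => f v = none).card := by
  classical
  let c : V → Option V → R := fun v o => o.elim x fun w => if G.Adj v w then 1 else 0
  have hrow : x • (1 : Matrix V V R) + G.lapMatrix R = fun v => ∑ o : Option V,
      c v o • ((fun w => (if v = w then 1 else 0) - (if o = some w then 1 else 0)) : V → R) := by
    ext v w
    rw [Finset.sum_apply]
    simp only [Fintype.sum_option, c, Matrix.add_apply, Matrix.smul_apply, Matrix.one_apply,
      SimpleGraph.lapMatrix, SimpleGraph.degMatrix, Matrix.sub_apply, Matrix.diagonal_apply,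
      SimpleGraph.adjMatrix_apply, Pi.smul_apply, smul_eq_mul, Option.elim, Option.some.injEq,
      mul_sub, Finset.sum_sub_distrib]
    by_cases h : v = w
    · subst h
      simp [← SimpleGraph.card_neighborFinset_eq_degree, SimpleGraph.neighborFinset_eq_filter]
    · simp [h]
  rw [hrow]
  have key := (Matrix.detRowAlternating (n := V) (R := R)).toMultilinearMap.map_sum
    (fun v (o : Option V) =>
      c v o • ((fun w => (if v = w then 1 else 0) - (if o = some w then 1 else 0)) : V → R))
  refine Eq.trans key ?_
  rw [rootedForests, Finset.sum_filter]
  refine Finset.sum_congr rfl fun f _ => ?_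
  refine Eq.trans ((Matrix.detRowAlternating (n := V) (R := R)).toMultilinearMap.map_smul_univ
    (fun v => c v (f v)) (parentMatrix R f)) ?_
  change (∏ v, c v (f v)) • (parentMatrix R f).det = _
  by_cases hf : IsRootedForest f
  · rw [det_parentMatrix_of_isRootedForest R hf, smul_eq_mul, mul_one]
    by_cases hadj : ∀ v w, f v = some w → G.Adj v w
    · rw [if_pos ⟨hf, hadj⟩, Finset.card_filter, ← Finset.prod_pow_eq_pow_sum]
      refine Finset.prod_congr rfl fun v _ => ?_
      cases h : f v with
      | none => simp [c]
      | some w => simp [c, hadj v w h]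
    · rw [if_neg fun h => hadj h.2]
      push Not at hadj
      obtain ⟨v, w, h, hvw⟩ := hadj
      exact Finset.prod_eq_zero (Finset.mem_univ v) (by simp [c, h, hvw])
  · rw [det_parentMatrix_of_not_isRootedForest R hf, smul_zero, if_neg fun h => hf h.1]

/-- The rooted spanning forests of `G` whose only root is `r`. -/
noncomputable def rootedTrees {V : Type*} [Fintype V] [DecidableEq V] (G : SimpleGraph V) (r : V) :
    Finset (V → Option V) :=
  (rootedForests G).filter fun f => ∀ v, f v = none ↔ v = r

/-- The edges joining each vertex to its parent. -/
def parentEdges {V : Type*} [Fintype V] [DecidableEq V] (f : V → Option V) : Finset (Sym2 V) :=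
  Finset.univ.biUnion fun v => (f v).toFinset.image fun w => s(v, w)

theorem mem_parentEdges {V : Type*} [Fintype V] [DecidableEq V] {f : V → Option V} {e : Sym2 V} :
    e ∈ parentEdges f ↔ ∃ v w, f v = some w ∧ s(v, w) = e := by
  simp [parentEdges]

theorem mem_rootedTrees {V : Type*} [Fintype V] [DecidableEq V] {G : SimpleGraph V} {r : V}
    {f : V → Option V} : f ∈ rootedTrees G r ↔
      (IsRootedForest f ∧ ∀ v w, f v = some w → G.Adj v w) ∧ ∀ v, f v = none ↔ v = r := by
  simp [rootedTrees, rootedForests]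

theorem connected_fromEdgeSet_parentEdges {V : Type*} [Fintype V] [DecidableEq V]
    {G : SimpleGraph V} {r : V} {f : V → Option V} (hf : f ∈ rootedTrees G r) :
    (SimpleGraph.fromEdgeSet (parentEdges f : Set (Sym2 V))).Connected := by
  obtain ⟨⟨hwf, hadj⟩, hroot⟩ := mem_rootedTrees.1 hf
  rw [SimpleGraph.connected_iff_exists_forall_reachable]
  refine ⟨r, fun v => ?_⟩
  induction v using hwf.induction with
  | _ v ih =>
    cases h : f v with
    | none => rw [(hroot v).1 h]
    | some w =>
      refine (ih w h).trans (SimpleGraph.Adj.reachable ?_)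
      rw [SimpleGraph.fromEdgeSet_adj]
      exact ⟨mem_parentEdges.2 ⟨v, w, h, Sym2.eq_swap⟩, (hadj v w h).ne'⟩

theorem card_parentEdges_lt {V : Type*} [Fintype V] [DecidableEq V]
    {G : SimpleGraph V} {r : V} {f : V → Option V} (hf : f ∈ rootedTrees G r) :
    (parentEdges f).card < Fintype.card V := by
  obtain ⟨-, hroot⟩ := mem_rootedTrees.1 hf
  have hsub : parentEdges f ⊆ (Finset.univ.erase r).image fun v => s(v, (f v).getD v) := by
    intro e he
    obtain ⟨v, w, h, rfl⟩ := mem_parentEdges.1 he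
    refine Finset.mem_image.2 ⟨v, ?_, by simp [h]⟩
    have : v ≠ r := fun hv => by simp [(hroot v).2 hv] at h
    simpa using this
  refine (Finset.card_le_card hsub).trans_lt (Finset.card_image_le.trans_lt ?_)
  exact Finset.card_erase_lt_of_mem (Finset.mem_univ r)

theorem isTree_fromEdgeSet_parentEdges {V : Type*} [Fintype V] [DecidableEq V]
    {G : SimpleGraph V} {r : V} {f : V → Option V} (hf : f ∈ rootedTrees G r) :
    (SimpleGraph.fromEdgeSet (parentEdges f : Set (Sym2 V))).IsTree := by
  have hconn := connected_fromEdgeSet_parentEdges hf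
  refine SimpleGraph.isTree_iff_connected_and_card.2 ⟨hconn, ?_⟩
  refine le_antisymm ?_ hconn.card_vert_le_card_edgeSet_add_one
  have hlt := card_parentEdges_lt hf
  have hle : Nat.card (SimpleGraph.fromEdgeSet (parentEdges f : Set (Sym2 V))).edgeSet ≤
      (parentEdges f).card := by
    rw [Nat.card_coe_set_eq, ← Set.ncard_coe_finset]
    refine Set.ncard_le_ncard ?_ (Finset.finite_toSet _)
    rw [SimpleGraph.edgeSet_fromEdgeSet]
    exact Set.sdiff_subset
  rw [← Nat.card_eq_fintype_card (α := V)] at hlt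
  omega

theorem injOn_parentEdges_rootedTrees {V : Type*} [Fintype V] [DecidableEq V]
    (G : SimpleGraph V) (r : V) : Set.InjOn parentEdges (rootedTrees G r : Set (V → Option V)) := by
  intro f hf g hg hfg
  obtain ⟨⟨hwf, -⟩, hfr⟩ := mem_rootedTrees.1 hf
  obtain ⟨-, hgr⟩ := mem_rootedTrees.1 hg
  funext v
  induction v using hwf.induction with
  | _ v ih =>
    cases h : f v with
    | none => exact ((hgr v).2 ((hfr v).1 h)).symm
    | some w =>
      have hmem : s(v, w) ∈ parentEdges g := hfg ▸ mem_parentEdges.2 ⟨v, w, h, rfl⟩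
      obtain ⟨a, b, hab, he⟩ := mem_parentEdges.1 hmem
      rcases Sym2.eq_iff.1 he with ⟨rfl, rfl⟩ | ⟨rfl, rfl⟩
      · exact hab.symm
      · exact absurd h (hwf.asymmetric _ _ ((ih _ h).trans hab))

theorem exists_mem_rootedTrees_of_isTree {V : Type*} [Fintype V] [DecidableEq V]
    {G : SimpleGraph V} (r : V) {t : Finset (Sym2 V)} (ht : (t : Set (Sym2 V)) ⊆ G.edgeSet)
    (htree : (SimpleGraph.fromEdgeSet (t : Set (Sym2 V))).IsTree) :
    ∃ f ∈ rootedTrees G r, parentEdges f = t := by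
  set T := SimpleGraph.fromEdgeSet (t : Set (Sym2 V)) with hT
  have hTG : T ≤ G := by
    rw [← SimpleGraph.edgeSet_subset_edgeSet, hT, SimpleGraph.edgeSet_fromEdgeSet]
    exact Set.sdiff_subset.trans ht
  have hTt : T.edgeSet = t := by
    rw [hT, SimpleGraph.edgeSet_fromEdgeSet, sdiff_eq_left, Set.disjoint_left]
    exact fun e he hd => G.not_isDiag_of_mem_edgeSet (ht he) hd
  have hstep : ∀ v, v ≠ r → ∃ w, T.Adj v w ∧ T.dist w r < T.dist v r := by
    intro v hv
    obtain ⟨p, hp⟩ := htree.connected.exists_walk_length_eq_dist v r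
    cases p with
    | nil => exact absurd rfl hv
    | cons hadj p =>
      refine ⟨_, hadj, ?_⟩
      rw [← hp, SimpleGraph.Walk.length_cons]
      exact Nat.lt_succ_of_le (SimpleGraph.dist_le p)
  choose! g hg using hstep
  let f : V → Option V := fun v => if v = r then none else some (g v)
  have hf : ∀ v w, f v = some w → v ≠ r ∧ g v = w := by
    intro v w h
    by_cases hv : v = r <;> simp_all [f]
  have hmem : f ∈ rootedTrees G r := by
    refine mem_rootedTrees.2 ⟨⟨?_, fun v w h => ?_⟩, fun v => ?_⟩
    · refine Subrelation.wf (r := InvImage (· < ·) fun v => T.dist v r) (fun {w v} h => ?_)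
        (InvImage.wf _ wellFounded_lt)
      obtain ⟨hv, rfl⟩ := hf v w h
      exact (hg v hv).2
    · obtain ⟨hv, rfl⟩ := hf v w h
      exact hTG (hg v hv).1
    · by_cases hv : v = r <;> simp [f, hv]
  refine ⟨f, hmem, ?_⟩
  have hsub : parentEdges f ⊆ t := by
    intro e he
    obtain ⟨v, w, h, rfl⟩ := mem_parentEdges.1 he
    obtain ⟨hv, rfl⟩ := hf v w h
    have := (hg v hv).1
    rw [hT, SimpleGraph.fromEdgeSet_adj] at this
    exact_mod_cast this.1
  refine hsub.antisymm fun e he => ?_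
  have hle := (SimpleGraph.isTree_iff_minimal_connected.1 htree).2
    (connected_fromEdgeSet_parentEdges hmem) (SimpleGraph.fromEdgeSet_mono (by exact_mod_cast hsub))
  have heT : e ∈ T.edgeSet := by rw [hTt]; exact_mod_cast he
  have := SimpleGraph.edgeSet_subset_edgeSet.2 hle heT
  rw [SimpleGraph.edgeSet_fromEdgeSet] at this
  exact_mod_cast this.1

theorem card_rootedTrees {V : Type*} [Fintype V] [DecidableEq V] (G : SimpleGraph V) (r : V) :
    (rootedTrees G r).card = complexity G := by
  rw [← Finset.card_image_of_injOn (injOn_parentEdges_rootedTrees G r), ← Set.ncard_coe_finset,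
    complexity]
  congr 1
  ext t
  rw [Finset.mem_coe, Finset.mem_image]
  constructor
  · rintro ⟨f, hf, rfl⟩
    refine ⟨fun e he => ?_, isTree_fromEdgeSet_parentEdges hf⟩
    obtain ⟨v, w, h, rfl⟩ := mem_parentEdges.1 he
    exact (mem_rootedTrees.1 hf).1.2 v w h
  · rintro ⟨ht, htree⟩
    exact exists_mem_rootedTrees_of_isTree r ht htree

/-- The matrix-tree theorem: the linear coefficient of `det (X + L)` is `|V|` times the number of
spanning trees. -/
theorem coeff_one_det_X_smul_one_add_lapMatrix {V : Type*} [Fintype V] [DecidableEq V]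
    (G : SimpleGraph V) [DecidableRel G.Adj] (R : Type*) [CommRing R] [IsDomain R] :
    ((Polynomial.X : Polynomial R) • (1 : Matrix V V (Polynomial R)) +
      G.lapMatrix (Polynomial R)).det.coeff 1 = (Fintype.card V * complexity G : ℕ) := by
  rw [det_smul_one_add_lapMatrix, Polynomial.finsetSum_coeff]
  simp only [Polynomial.coeff_X_pow]
  rw [Finset.sum_boole]
  congr 1
  have hunion : (rootedForests G).filter
      (fun f => 1 = (Finset.univ.filter fun v => f v = none).card) =
      Finset.univ.biUnion (rootedTrees G) := by
    ext f
    simp only [Finset.mem_filter, Finset.mem_biUnion, Finset.mem_univ, true_and, rootedTrees]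
    rw [exists_and_left]
    refine and_congr_right fun _ => ?_
    rw [eq_comm, Finset.card_eq_one]
    simp [Finset.ext_iff]
  rw [hunion, Finset.card_biUnion]
  · simp [card_rootedTrees]
  · intro r _ s _ hrs
    refine Finset.disjoint_left.2 fun f hr hs => hrs ?_
    exact ((mem_rootedTrees.1 hs).2 r).1 (((mem_rootedTrees.1 hr).2 r).2 rfl)

/-- Adjacency in the star on `Fin q` with centre `0`. -/
def starAdj {q : ℕ} (x y : Fin q) : Prop := (x : ℕ) = 0 ↔ (y : ℕ) ≠ 0

instance {q : ℕ} : DecidableRel (starAdj (q := q)) := fun _ _ => inferInstanceAs (Decidable (_ ↔ _))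

theorem starAdj.ne {q : ℕ} {x y : Fin q} (h : starAdj x y) : x ≠ y := by
  rintro rfl
  unfold starAdj at h
  tauto

theorem starAdj.symm {q : ℕ} {x y : Fin q} (h : starAdj x y) : starAdj y x := by
  unfold starAdj at *
  tauto

theorem mem_supp {n q : ℕ} {a : Fin n → Fin q} {i : Fin n} : i ∈ supp a ↔ (a i : ℕ) ≠ 0 := by
  simp [supp]

theorem cubeAdjRel_update {n q : ℕ} {a : Fin n → Fin q} {i : Fin n} {x : Fin q}
    (ha : (a i : ℕ) = 0) (hx : (x : ℕ) ≠ 0) : cubeAdjRel a (Function.update a i x) := by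
  have hnot : i ∉ supp a := by simpa [mem_supp] using ha
  have hins : supp (Function.update a i x) = insert i (supp a) := by
    ext j
    by_cases hj : j = i
    · subst hj; simp [mem_supp, hx]
    · simp [mem_supp, hj]
  refine ⟨Or.inl (hins ▸ Finset.subset_insert _ _), Or.inl ?_, fun j hj => ?_⟩
  · rw [hins, Finset.card_insert_of_notMem hnot]
  · have : j ≠ i := fun h => hnot (h ▸ (Finset.mem_inter.1 hj).1)
    simp [this]

theorem exists_update_of_supp_subset {n q : ℕ} {a b : Fin n → Fin q} (hsub : supp a ⊆ supp b)
    (hcard : (supp a).card + 1 = (supp b).card) (heq : ∀ i ∈ supp a ∩ supp b, a i = b i) :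
    ∃ i, starAdj (a i) (b i) ∧ b = Function.update a i (b i) := by
  obtain ⟨i, hi, hins⟩ := Finset.exists_eq_insert_iff.2 ⟨hsub, hcard⟩
  have hbi : i ∈ supp b := hins ▸ Finset.mem_insert_self _ _
  refine ⟨i, ?_, ?_⟩
  · rw [mem_supp] at hi hbi
    unfold starAdj
    tauto
  · funext j
    by_cases hj : j = i
    · subst hj; simp
    · rw [Function.update_of_ne hj]
      by_cases hja : j ∈ supp a
      · exact (heq j (Finset.mem_inter.2 ⟨hja, hsub hja⟩)).symm
      · have hjb : j ∉ supp b := by simp [← hins, hj, hja]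
        rw [mem_supp, not_not] at hja hjb
        exact Fin.ext (hjb.trans hja.symm)

/-- The nonbinary cube is the Cartesian power of a star. -/
theorem nonbinaryCube_adj {n q : ℕ} {a b : Fin n → Fin q} :
    (nonbinaryCube n q).Adj a b ↔ ∃ i x, starAdj (a i) x ∧ b = Function.update a i x := by
  rw [nonbinaryCube, SimpleGraph.fromRel_adj]
  constructor
  · have key : ∀ {a b : Fin n → Fin q}, cubeAdjRel a b →
        ∃ i x, starAdj (a i) x ∧ b = Function.update a i x := by
      rintro a b ⟨hsub, hcard, heq⟩
      rcases hcard with hcard | hcard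
      · have hsub' : supp a ⊆ supp b := by
          refine hsub.resolve_right fun h => ?_
          have := Finset.card_le_card h
          omega
        obtain ⟨i, hi⟩ := exists_update_of_supp_subset hsub' hcard heq
        exact ⟨i, b i, hi⟩
      · have hsub' : supp b ⊆ supp a := by
          refine hsub.resolve_left fun h => ?_
          have := Finset.card_le_card h
          omega
        obtain ⟨i, hi, ha⟩ := exists_update_of_supp_subset hsub' hcard
          (fun i hi => (heq i (Finset.inter_comm (supp b) _ ▸ hi)).symm)
        refine ⟨i, b i, hi.symm, ?_⟩
        rw [ha]
        simp
    have hsymm : ∀ {a b : Fin n → Fin q}, cubeAdjRel b a → cubeAdjRel a b :=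
      fun ⟨h₁, h₂, h₃⟩ => ⟨h₁.symm, h₂.symm, fun i hi =>
        (h₃ i (Finset.inter_comm (supp _) _ ▸ hi)).symm⟩
    rintro ⟨-, h | h⟩
    · exact key h
    · exact key (hsymm h)
  · rintro ⟨i, x, hx, rfl⟩
    refine ⟨fun h => hx.ne ?_, ?_⟩
    · simpa using congrFun h i
    · by_cases ha : (a i : ℕ) = 0
      · exact Or.inl (cubeAdjRel_update ha (hx.1 ha))
      · refine Or.inr ?_
        have hx0 : (x : ℕ) = 0 := by
          unfold starAdj at hx
          tauto
        have := cubeAdjRel_update (a := Function.update a i x) (i := i) (x := a i)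
          (by simpa using hx0) ha
        simpa using this

theorem sum_neighborFinset_nonbinaryCube {n q : ℕ} [DecidableRel (nonbinaryCube n q).Adj]
    {M : Type*} [AddCommMonoid M] (a : Fin n → Fin q) (g : (Fin n → Fin q) → M) :
    ∑ b ∈ (nonbinaryCube n q).neighborFinset a, g b =
      ∑ i, ∑ x, if starAdj (a i) x then g (Function.update a i x) else 0 := by
  rw [← Finset.sum_product', ← Finset.sum_filter]
  symm
  refine Finset.sum_bij (fun p _ => Function.update a p.1 p.2) ?_ ?_ ?_ (fun _ _ => rfl)
  · rintro ⟨i, x⟩ h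
    rw [SimpleGraph.mem_neighborFinset, nonbinaryCube_adj]
    exact ⟨i, x, by simpa using h, rfl⟩
  · rintro ⟨i, x⟩ h ⟨j, y⟩ h' heq
    have hx : starAdj (a i) x := by simpa using h
    dsimp only at heq
    have hij : i = j := by
      by_contra hij
      have := congrFun heq i
      rw [Function.update_self, Function.update_of_ne hij] at this
      exact hx.ne this.symm
    subst hij
    have := congrFun heq i
    simp only [Function.update_self] at this
    rw [this]
  · intro b hb
    rw [SimpleGraph.mem_neighborFinset, nonbinaryCube_adj] at hb
    obtain ⟨i, x, hx, rfl⟩ := hb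
    exact ⟨(i, x), by simpa using hx, rfl⟩

/-- The `n`-fold tensor power of a matrix. -/
def tensorPow {α R : Type*} [CommRing R] (n : ℕ) (P : Matrix α α R) :
    Matrix (Fin n → α) (Fin n → α) R :=
  fun a b => ∏ i, P (a i) (b i)

theorem tensorPow_mul {α R : Type*} [Fintype α] [DecidableEq α] [CommRing R] (n : ℕ)
    (P Q : Matrix α α R) : tensorPow n P * tensorPow n Q = tensorPow n (P * Q) := by
  ext a b
  simp only [Matrix.mul_apply, tensorPow, ← Finset.prod_mul_distrib]
  rw [Finset.prod_univ_sum, Fintype.piFinset_univ]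

theorem tensorPow_one {α R : Type*} [DecidableEq α] [CommRing R] (n : ℕ) :
    tensorPow n (1 : Matrix α α R) = 1 := by
  ext a b
  rw [Matrix.one_apply]
  split_ifs with h
  · exact Finset.prod_eq_one fun i _ => h ▸ Matrix.one_apply_eq _
  · obtain ⟨i, hi⟩ := Function.ne_iff.1 h
    exact Finset.prod_eq_zero (Finset.mem_univ i) (Matrix.one_apply_ne hi)

/-- A basis of eigenvectors of the star Laplacian diagonalises the Laplacian of the cube. -/
theorem lapMatrix_nonbinaryCube_mul_tensorPow {n q : ℕ} [DecidableRel (nonbinaryCube n q).Adj]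
    {R : Type*} [CommRing R] (P : Matrix (Fin q) (Fin q) R) (d : Fin q → R)
    (hP : ∀ x y, (∑ z, if starAdj x z then P x y - P z y else 0) = P x y * d y) :
    (nonbinaryCube n q).lapMatrix R * tensorPow n P =
      tensorPow n P * Matrix.diagonal fun b => ∑ i, d (b i) := by
  ext a b
  rw [Matrix.mul_diagonal]
  change ((nonbinaryCube n q).lapMatrix R).mulVec (fun c => tensorPow n P c b) a = _
  rw [SimpleGraph.lapMatrix_mulVec_apply, ← SimpleGraph.card_neighborFinset_eq_degree,
    ← nsmul_eq_mul, ← Finset.sum_const, ← Finset.sum_sub_distrib,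
    sum_neighborFinset_nonbinaryCube, Finset.mul_sum]
  refine Finset.sum_congr rfl fun i _ => ?_
  have hsplit : ∀ c : Fin n → Fin q, tensorPow n P c b =
      P (c i) (b i) * ∏ j ∈ Finset.univ.erase i, P (c j) (b j) := fun c =>
    (Finset.mul_prod_erase _ _ (Finset.mem_univ i)).symm
  have hupd : ∀ x, tensorPow n P (Function.update a i x) b =
      P x (b i) * ∏ j ∈ Finset.univ.erase i, P (a j) (b j) := fun x => by
    rw [hsplit, Function.update_self]
    congr 1
    refine Finset.prod_congr rfl fun j hj => ?_
    rw [Function.update_of_ne (Finset.ne_of_mem_erase hj)]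
  simp only [hupd]
  rw [hsplit a, mul_right_comm, ← hP, Finset.sum_mul]
  refine Finset.sum_congr rfl fun x _ => ?_
  split_ifs <;> ring

theorem det_smul_one_add_lapMatrix_nonbinaryCube {n q : ℕ} [DecidableRel (nonbinaryCube n q).Adj]
    {R : Type*} [CommRing R] (P Q : Matrix (Fin q) (Fin q) R) (d : Fin q → R) (hQP : Q * P = 1)
    (hP : ∀ x y, (∑ z, if starAdj x z then P x y - P z y else 0) = P x y * d y) (t : R) :
    (t • (1 : Matrix (Fin n → Fin q) (Fin n → Fin q) R) + (nonbinaryCube n q).lapMatrix R).det =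
      ∏ b : Fin n → Fin q, (t + ∑ i, d (b i)) := by
  have hunit : (tensorPow n Q).det * (tensorPow n P).det = 1 := by
    rw [← Matrix.det_mul, tensorPow_mul, hQP, tensorPow_one, Matrix.det_one]
  have hmul : (t • 1 + (nonbinaryCube n q).lapMatrix R) * tensorPow n P =
      tensorPow n P * Matrix.diagonal fun b => t + ∑ i, d (b i) := by
    rw [add_mul, lapMatrix_nonbinaryCube_mul_tensorPow P d hP, Matrix.smul_mul, one_mul]
    ext a b
    simp only [Matrix.add_apply, Matrix.smul_apply, Matrix.mul_diagonal, smul_eq_mul]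
    ring
  have hdet := congrArg Matrix.det hmul
  rw [Matrix.det_mul, Matrix.det_mul, Matrix.det_diagonal] at hdet
  linear_combination (tensorPow n Q).det * hdet -
    ((t • (1 : Matrix (Fin n → Fin q) (Fin n → Fin q) R) + (nonbinaryCube n q).lapMatrix R).det -
      ∏ b : Fin n → Fin q, (t + ∑ i, d (b i))) * hunit

/-- The Laplacian eigenvalues of the star on `Fin q`. -/
def starEigenvalue {q : ℕ} (y : Fin q) : ℕ :=
  if (y : ℕ) = 0 then 0 else if (y : ℕ) = 1 then q else 1

/-- The columns are Laplacian eigenvectors of the star on `Fin q`. -/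
def starEigenbasis (q : ℕ) : Matrix (Fin q) (Fin q) ℚ := fun x y =>
  if (y : ℕ) = 0 then 1
  else if (y : ℕ) = 1 then (if (x : ℕ) = 0 then (q : ℚ) - 1 else -1)
  else (if (x : ℕ) = 1 then 1 else 0) - (if x = y then 1 else 0)

theorem starEigenbasis_eigenvector {q : ℕ} (hq : 2 ≤ q) (x y : Fin q) :
    (∑ z, if starAdj x z then starEigenbasis q x y - starEigenbasis q z y else 0) =
      starEigenbasis q x y * starEigenvalue y := by
  obtain ⟨p, rfl⟩ := Nat.exists_eq_add_of_le' hq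
  rw [Fin.sum_univ_succ, Fin.sum_univ_succ]
  induction x using Fin.cases with
  | zero =>
    induction y using Fin.cases with
    | zero => simp [starAdj, starEigenbasis, starEigenvalue]
    | succ y =>
      induction y using Fin.cases with
      | zero =>
        simp [starAdj, starEigenbasis, starEigenvalue]
        ring
      | succ y =>
        simp [starAdj, starEigenbasis, starEigenvalue, Fin.ext_iff]
        simp [← Fin.ext_iff, Finset.filter_eq']
  | succ x =>
    induction y using Fin.cases with
    | zero => simp [starAdj, starEigenbasis, starEigenvalue]
    | succ y =>
      induction y using Fin.cases with
      | zero =>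
        simp [starAdj, starEigenbasis, starEigenvalue]
        ring
      | succ y =>
        simp [starAdj, starEigenbasis, starEigenvalue]
        exact (Fin.succ_ne_zero _).symm

theorem isUnit_starEigenbasis {q : ℕ} (hq : 2 ≤ q) : IsUnit (starEigenbasis q) := by
  obtain ⟨p, rfl⟩ := Nat.exists_eq_add_of_le' hq
  rw [Matrix.isUnit_iff_isUnit_det, isUnit_iff_ne_zero]
  intro hdet
  obtain ⟨c, hc0, hc⟩ := Matrix.exists_mulVec_eq_zero_iff.2 hdet
  have hrow : ∀ x, ∑ y, starEigenbasis (p + 2) x y * c y = 0 := fun x => congrFun hc x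
  simp only [Fin.sum_univ_succ] at hrow
  have h0 := hrow 0
  have h1 := hrow 1
  have h2 := fun x : Fin p => hrow x.succ.succ
  simp [starEigenbasis, Fin.ext_iff] at h0 h1 h2
  simp only [← Fin.ext_iff, Finset.sum_ite_eq, Finset.mem_univ, if_true] at h2
  have hc2 : ∀ x : Fin p, c x.succ.succ = c 0 - c 1 := fun x => by linarith [h2 x]
  have hc01 : c 0 - c 1 = 0 := by
    rw [Finset.sum_congr rfl fun x _ => hc2 x] at h1
    simp only [Finset.sum_const, Finset.card_univ, Fintype.card_fin, nsmul_eq_mul] at h1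
    have : ((p : ℚ) + 1) * (c 0 - c 1) = 0 := by linarith
    exact (mul_eq_zero.1 this).resolve_left (by positivity)
  have hc1 : c 1 = 0 := by
    have : ((p : ℚ) + 2) * c 1 = 0 := by linarith
    exact (mul_eq_zero.1 this).resolve_left (by positivity)
  refine hc0 (funext fun x => ?_)
  induction x using Fin.cases with
  | zero => simpa [hc1] using hc01
  | succ x =>
    induction x using Fin.cases with
    | zero => exact hc1
    | succ x => exact (hc2 x).trans hc01

/-- The number of coordinates equal to `1`. -/
def countOne {n q : ℕ} (b : Fin n → Fin q) : ℕ :=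
  ∑ i, if (b i : ℕ) = 1 then 1 else 0

/-- The number of coordinates that are at least `2`. -/
def countLarge {n q : ℕ} (b : Fin n → Fin q) : ℕ :=
  ∑ i, if 2 ≤ (b i : ℕ) then 1 else 0

theorem sum_starEigenvalue {n q : ℕ} (b : Fin n → Fin q) :
    ∑ i, starEigenvalue (b i) = q * countOne b + countLarge b := by
  rw [countOne, countLarge, Finset.mul_sum, ← Finset.sum_add_distrib]
  refine Finset.sum_congr rfl fun i _ => ?_
  unfold starEigenvalue
  split_ifs <;> omega

/-- The Laplacian eigenvalue `q * m + l` of the cube, with the zero eigenvalue replaced by `1`. -/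
def cubeEigenvalue (q m l : ℕ) : ℕ := if m = 0 ∧ l = 0 then 1 else q * m + l

theorem card_mul_complexity_nonbinaryCube {n q : ℕ} (hq : 2 ≤ q) :
    q ^ n * complexity (nonbinaryCube n q) =
      ∏ b : Fin n → Fin q, cubeEigenvalue q (countOne b) (countLarge b) := by
  classical
  obtain ⟨u, hu⟩ := isUnit_starEigenbasis hq
  have hQP : ((↑u⁻¹ : Matrix (Fin q) (Fin q) ℚ).map Polynomial.C) *
      (starEigenbasis q).map Polynomial.C = 1 := by
    rw [← Matrix.map_mul, ← hu, Units.inv_mul, Matrix.map_one _ (map_zero _) (map_one _)]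
  have hcoeff := coeff_one_det_X_smul_one_add_lapMatrix (nonbinaryCube n q) ℚ
  rw [det_smul_one_add_lapMatrix_nonbinaryCube _ _
    (fun y => Polynomial.C (starEigenvalue y : ℚ)) hQP] at hcoeff
  · have : NeZero q := ⟨by omega⟩
    have hzero : ∀ b : Fin n → Fin q, countOne b = 0 ∧ countLarge b = 0 ↔ b = 0 := by
      intro b
      simp only [countOne, countLarge, Finset.sum_eq_zero_iff, Finset.mem_univ, true_imp_iff,
        funext_iff, ← forall_and, Pi.zero_apply, ite_eq_right_iff]
      simp only [one_ne_zero, imp_false]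
      refine forall_congr' fun i => ?_
      rw [← Fin.val_eq_zero_iff]
      omega
    have hprod : ∏ b : Fin n → Fin q,
        (Polynomial.X + ∑ i, Polynomial.C (starEigenvalue (b i) : ℚ)) =
        Polynomial.X * ∏ b ∈ (Finset.univ : Finset (Fin n → Fin q)).erase 0,
          (Polynomial.X + Polynomial.C ((q * countOne b + countLarge b : ℕ) : ℚ)) := by
      rw [← Finset.mul_prod_erase _ _ (Finset.mem_univ (0 : Fin n → Fin q))]
      congr 1
      · simp [starEigenvalue]
      · refine Finset.prod_congr rfl fun b _ => ?_
        rw [← sum_starEigenvalue]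
        simp
    rw [hprod, Polynomial.coeff_X_mul, Polynomial.coeff_zero_prod] at hcoeff
    rw [← Finset.mul_prod_erase _ _ (Finset.mem_univ (0 : Fin n → Fin q)), cubeEigenvalue,
      if_pos ((hzero 0).2 rfl), one_mul]
    have hrest : ∏ b ∈ (Finset.univ : Finset (Fin n → Fin q)).erase 0,
        cubeEigenvalue q (countOne b) (countLarge b) =
        ∏ b ∈ (Finset.univ : Finset (Fin n → Fin q)).erase 0,
          (q * countOne b + countLarge b) :=
      Finset.prod_congr rfl fun b hb =>
        if_neg fun h => Finset.ne_of_mem_erase hb ((hzero b).1 h)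
    rw [hrest]
    simp only [Polynomial.coeff_add, Polynomial.coeff_X_zero, Polynomial.coeff_C_zero, zero_add,
      Fintype.card_fun, Fintype.card_fin] at hcoeff
    exact_mod_cast hcoeff.symm
  · intro x y
    have := congrArg (Polynomial.C (R := ℚ)) (starEigenbasis_eigenvector hq x y)
    rw [map_sum, map_mul] at this
    simpa only [apply_ite (Polynomial.C (R := ℚ)), map_sub, map_zero, Matrix.map_apply] using this

theorem countOne_cons {n q : ℕ} (x : Fin q) (b : Fin n → Fin q) :
    countOne (Fin.cons x b : Fin (n + 1) → Fin q) =
      (if (x : ℕ) = 1 then 1 else 0) + countOne b := by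
  simp only [countOne, Fin.sum_univ_succ, Fin.cons_zero, Fin.cons_succ]

theorem countLarge_cons {n q : ℕ} (x : Fin q) (b : Fin n → Fin q) :
    countLarge (Fin.cons x b : Fin (n + 1) → Fin q) =
      (if 2 ≤ (x : ℕ) then 1 else 0) + countLarge b := by
  simp only [countLarge, Fin.sum_univ_succ, Fin.cons_zero, Fin.cons_succ]

theorem card_countOne_countLarge (n p m l : ℕ) :
    (Finset.univ.filter fun b : Fin n → Fin (p + 2) => countOne b = m ∧ countLarge b = l).card =
      p ^ l * n.choose l * (n - l).choose m := by
  induction n generalizing m l with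
  | zero => cases m <;> cases l <;> simp [countOne, countLarge]
  | succ n ih =>
    have hrec : (Finset.univ.filter fun b : Fin (n + 1) → Fin (p + 2) =>
        countOne b = m ∧ countLarge b = l).card =
        (Finset.univ.filter fun b : Fin n → Fin (p + 2) =>
          countOne b = m ∧ countLarge b = l).card +
        ((Finset.univ.filter fun b : Fin n → Fin (p + 2) =>
          1 + countOne b = m ∧ countLarge b = l).card +
        p * (Finset.univ.filter fun b : Fin n → Fin (p + 2) =>
          countOne b = m ∧ 1 + countLarge b = l).card) := by
      simp only [Finset.card_filter]
      rw [← (Fin.consEquiv fun _ => Fin (p + 2)).sum_comp, Fintype.sum_prod_type,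
        Fin.sum_univ_succ, Fin.sum_univ_succ]
      simp [Fin.consEquiv, countOne_cons, countLarge_cons]
    rw [hrec, ih]
    rcases m with - | m <;> rcases l with - | l
    · simp
    · simp [add_comm 1, ih, Nat.choose_succ_succ]
      ring
    · simp [add_comm 1, ih, Nat.choose_succ_succ]
      ring
    · simp only [add_comm 1, add_left_inj, ih, Nat.add_sub_add_right]
      rcases lt_or_ge l n with h | h
      · obtain ⟨k, rfl⟩ := Nat.exists_eq_add_of_lt h
        have h1 : l + k + 1 - (l + 1) = k := by omega
        have h2 : l + k + 1 - l = k + 1 := by omega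
        rw [h1, h2, Nat.choose_succ_succ (l + k + 1) l, Nat.choose_succ_succ k m]
        ring
      · rw [Nat.choose_eq_zero_of_lt (show n < l + 1 by omega), Nat.choose_succ_succ n l,
          Nat.choose_eq_zero_of_lt (show n < l + 1 by omega)]
        ring

theorem countOne_add_countLarge_le {n q : ℕ} (b : Fin n → Fin q) :
    countOne b + countLarge b ≤ n := by
  rw [countOne, countLarge, ← Finset.sum_add_distrib]
  refine (Finset.sum_le_card_nsmul _ _ 1 fun i _ => ?_).trans (by simp)
  split_ifs <;> omega

theorem prod_countOne_countLarge {M : Type*} [CommMonoid M] (n p : ℕ) (F : ℕ → ℕ → M) :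
    ∏ b : Fin n → Fin (p + 2), F (countOne b) (countLarge b) =
      ∏ l ∈ Finset.range (n + 1), ∏ m ∈ Finset.range (n - l + 1),
        F m l ^ (p ^ l * n.choose l * (n - l).choose m) := by
  rw [Finset.prod_sigma', ← Finset.prod_fiberwise_of_maps_to
    (g := fun b : Fin n → Fin (p + 2) => (⟨countLarge b, countOne b⟩ : Σ _ : ℕ, ℕ))]
  · refine Finset.prod_congr rfl fun x _ => ?_
    rw [← card_countOne_countLarge, ← Finset.prod_const]
    refine Finset.prod_congr ?_ ?_
    · ext b
      cases x
      simp [and_comm]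
    · intro b hb
      rw [Finset.mem_filter] at hb
      rw [hb.2.1, hb.2.2]
  · intro b _
    have := countOne_add_countLarge_le b
    simp only [Finset.mem_sigma, Finset.mem_range]
    omega

theorem sum_chooseDiff {N s : ℕ} (hs : 2 * s ≤ N) :
    ∑ r ∈ Finset.range (s + 1), chooseDiff N r = N.choose s := by
  induction s with
  | zero => simp [chooseDiff]
  | succ s ih =>
    rw [Finset.sum_range_succ, ih (by omega)]
    have := Nat.choose_le_succ_of_lt_half_left (r := s) (n := N) (by omega)
    simp only [chooseDiff, Nat.succ_ne_zero, if_false, Nat.add_sub_cancel]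
    omega

theorem prod_pow_chooseDiff {M : Type*} [CommMonoid M] (N : ℕ) (g : ℕ → M) :
    ∏ r ∈ (Finset.range (N + 1)).filter (fun r => 2 * r ≤ N),
      ∏ m ∈ Finset.Icc r (N - r), g m ^ chooseDiff N r =
      ∏ m ∈ Finset.range (N + 1), g m ^ N.choose m := by
  rw [Finset.prod_comm' (t' := Finset.range (N + 1))
    (s' := fun m => Finset.range (min m (N - m) + 1))]
  · refine Finset.prod_congr rfl fun m hm => ?_
    rw [Finset.prod_pow_eq_pow_sum, sum_chooseDiff (by omega)]
    rcases le_total m (N - m) with h | h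
    · rw [min_eq_left h]
    · rw [min_eq_right h, Nat.choose_symm (by simpa [Nat.lt_succ_iff] using hm)]
  · intro r m
    simp only [Finset.mem_filter, Finset.mem_range, Finset.mem_Icc]
    omega

theorem prod_cubeEigenvalue_eq (n q : ℕ) :
    ∏ k ∈ Finset.range (n + 1), ∏ l ∈ Finset.Icc (2 * k - n) k,
      (∏ j ∈ Finset.Icc k (n + l - k), cubeEigenvalue q (j - l) l) ^
        ((q - 2) ^ l * n.choose l * chooseDiff (n - l) (k - l)) =
      ∏ l ∈ Finset.range (n + 1), ∏ m ∈ Finset.range (n - l + 1),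
        cubeEigenvalue q m l ^ ((q - 2) ^ l * n.choose l * (n - l).choose m) := by
  rw [Finset.prod_comm' (t' := Finset.range (n + 1))
    (s' := fun l => (Finset.Icc l n).filter fun k => 2 * k ≤ n + l)]
  · refine Finset.prod_congr rfl fun l hl => ?_
    rw [Finset.mem_range] at hl
    simp only [pow_mul]
    rw [← prod_pow_chooseDiff]
    refine Finset.prod_nbij' (fun k => k - l) (fun r => r + l) ?_ ?_ ?_ ?_ ?_
    · simp only [Finset.mem_filter, Finset.mem_range, Finset.mem_Icc]; omega
    · simp only [Finset.mem_filter, Finset.mem_range, Finset.mem_Icc]; omega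
    · simp only [Finset.mem_filter, Finset.mem_Icc]; omega
    · simp only [Finset.mem_filter, Finset.mem_range]; omega
    · intro k hk
      rw [Finset.mem_filter, Finset.mem_Icc] at hk
      simp only [← Finset.prod_pow]
      refine Finset.prod_nbij' (fun j => j - l) (fun m => m + l) ?_ ?_ ?_ ?_ fun _ _ => rfl
      all_goals simp only [Finset.mem_Icc]; omega
  · intro k l
    simp only [Finset.mem_filter, Finset.mem_range, Finset.mem_Icc]
    omega

theorem prod_cubeEigenvalue_zero_right (n q : ℕ) :
    ∏ j ∈ Finset.Icc 0 n, cubeEigenvalue q j 0 = q ^ n * n.factorial := by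
  induction n with
  | zero => simp [cubeEigenvalue]
  | succ n ih =>
    rw [Finset.prod_Icc_succ_top (Nat.zero_le _), ih, Nat.factorial_succ, cubeEigenvalue]
    simp only [Nat.succ_ne_zero, false_and, if_false]
    ring

theorem complexity_nonbinaryCube (q n : ℕ) (hq : 2 ≤ q) (hn : 1 ≤ n) :
    complexity (nonbinaryCube n q) =
      n.factorial *
        ∏ k ∈ Finset.Icc 1 n, ∏ l ∈ Finset.Icc (2 * k - n) k,
          (∏ j ∈ Finset.Icc k (n + l - k), (q * j - (q - 1) * l)) ^
            ((q - 2) ^ l * n.choose l * chooseDiff (n - l) (k - l)) := by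
  have hcount : ∏ b : Fin n → Fin q, cubeEigenvalue q (countOne b) (countLarge b) =
      ∏ l ∈ Finset.range (n + 1), ∏ m ∈ Finset.range (n - l + 1),
        cubeEigenvalue q m l ^ ((q - 2) ^ l * n.choose l * (n - l).choose m) := by
    obtain ⟨p, rfl⟩ := Nat.exists_eq_add_of_le' hq
    exact prod_countOne_countLarge n p (cubeEigenvalue (p + 2))
  have hfactor : ∏ k ∈ Finset.Icc 1 n, ∏ l ∈ Finset.Icc (2 * k - n) k,
      (∏ j ∈ Finset.Icc k (n + l - k), cubeEigenvalue q (j - l) l) ^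
        ((q - 2) ^ l * n.choose l * chooseDiff (n - l) (k - l)) =
      ∏ k ∈ Finset.Icc 1 n, ∏ l ∈ Finset.Icc (2 * k - n) k,
          (∏ j ∈ Finset.Icc k (n + l - k), (q * j - (q - 1) * l)) ^
            ((q - 2) ^ l * n.choose l * chooseDiff (n - l) (k - l)) := by
    refine Finset.prod_congr rfl fun k hk => Finset.prod_congr rfl fun l hl => ?_
    congr 1
    refine Finset.prod_congr rfl fun j hj => ?_
    rw [Finset.mem_Icc] at hk hl hj
    obtain ⟨m, rfl⟩ := Nat.exists_eq_add_of_le' (hl.2.trans hj.1)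
    obtain ⟨s, rfl⟩ := Nat.exists_eq_add_of_le' (show 1 ≤ q by omega)
    rw [cubeEigenvalue, if_neg (by omega), Nat.add_sub_cancel, Nat.add_sub_cancel]
    symm
    rw [Nat.sub_eq_iff_eq_add (by nlinarith)]
    ring
  have hmain := card_mul_complexity_nonbinaryCube (n := n) hq
  rw [hcount, ← prod_cubeEigenvalue_eq, Finset.range_eq_Ico, Finset.prod_eq_prod_Ico_succ_bot
    (Nat.succ_pos n)] at hmain
  have hIco : Finset.Ico (0 + 1) (n + 1) = Finset.Icc 1 n := by
    ext k
    simp only [Finset.mem_Ico, Finset.mem_Icc]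
    omega
  have hzero : ∏ l ∈ Finset.Icc (2 * 0 - n) 0,
      (∏ j ∈ Finset.Icc 0 (n + l - 0), cubeEigenvalue q (j - l) l) ^
        ((q - 2) ^ l * n.choose l * chooseDiff (n - l) (0 - l)) = q ^ n * n.factorial := by
    simp [chooseDiff, prod_cubeEigenvalue_zero_right]
  rw [hIco, hfactor, hzero, mul_assoc] at hmain
  exact Nat.eq_of_mul_eq_mul_left (by positivity) hmain
end

section
/- Let q be a prime power and n ≥ 1. The characteristic polynomial of the Laplacian of C_{F_q}(n) equals ∏_{k=0}^{⌊n/2⌋} ( charpoly of N(k, n−k, n) )^{ [n choose k]_q − [n choose k−1]_q } (with [n choose −1]_q = 0); that is, the Laplacian of C_{F_q}(n) is similar to a block diagonal matrix in which, for each 0 ≤ k ≤ n/2, the block N(k, n−k, n) occurs with multiplicity [n choose k]_q − [n choose k−1]_q. -/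
/-- The vector space analog `C_{F_q}(n)` of the hypercube. -/
def vsCube (F : Type) [Field F] (n : ℕ) : SimpleGraph (Submodule F (Fin n → F)) :=
  SimpleGraph.fromRel
    (fun X Y => X ≤ Y ∧ Module.finrank F Y = Module.finrank F X + 1)

noncomputable instance fintypeSubmodule (F : Type) [Field F] [Fintype F] (n : ℕ) :
    Fintype (Submodule F (Fin n → F)) :=
  have : Finite (Submodule F (Fin n → F)) :=
    Finite.of_injective (fun X => (X : Set (Fin n → F))) SetLike.coe_injective
  Fintype.ofFinite _

/-- The `q`-integer `[m]_q = 1 + q + ⋯ + q^{m-1}`. -/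
def qInt (q m : ℕ) : ℕ := ∑ i ∈ Finset.range m, q ^ i

/-- The Gaussian binomial coefficient `[n choose k]_q`: the number of `k`-dimensional
subspaces of `F^n` (where `q = |F|`). -/
noncomputable def gauss (F : Type) [Field F] (n k : ℕ) : ℕ :=
  Nat.card {X : Submodule F (Fin n → F) // Module.finrank F X = k}

/-- `[n choose k]_q - [n choose k-1]_q`, with the convention `[n choose -1]_q = 0`. -/
noncomputable def gaussDiff (F : Type) [Field F] (n k : ℕ) : ℕ :=
  gauss F n k - if k = 0 then 0 else gauss F n (k - 1)

/-- The entry in position `(i, j)` of the tridiagonal matrix `N(k, n-k, n)` of the paper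
(rows and columns indexed by `{k, …, n-k}`). -/
noncomputable def Nent (q n k : ℕ) (i j : ℕ) : ℝ :=
  if i = j then ((qInt q j + qInt q (n - j) : ℕ) : ℝ)
  else if i + 1 = j then -Real.sqrt ((q ^ k * qInt q (j - k) * qInt q (n - k + 1 - j) : ℕ))
  else if j + 1 = i then -Real.sqrt ((q ^ k * qInt q (i - k) * qInt q (n - k + 1 - i) : ℕ))
  else 0

/-- Multiplicativity of the characteristic polynomial over diagonal blocks. -/
theorem Matrix.charpoly_blockDiagonal' {P R : Type*} [Fintype P] [DecidableEq P] [CommRing R]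
    {d : P → Type*} [∀ p, Fintype (d p)] [∀ p, DecidableEq (d p)]
    (M : ∀ p, Matrix (d p) (d p) R) :
    (Matrix.blockDiagonal' M).charpoly = ∏ p, (M p).charpoly := by
  let _ : LinearOrder P := LinearOrder.lift' (Fintype.equivFin P) (Fintype.equivFin P).injective
  have h : (Matrix.blockDiagonal' M).charmatrix =
      Matrix.blockDiagonal' fun p => (M p).charmatrix := by
    ext ⟨p, a⟩ ⟨p', a'⟩ : 1
    by_cases hp : p = p'
    · subst hp
      by_cases ha : a = a'
      · subst ha; simp [Matrix.charmatrix_apply_eq]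
      · have : (⟨p, a⟩ : Σ p, d p) ≠ ⟨p, a'⟩ := by simpa using ha
        simp [Matrix.charmatrix_apply_ne _ _ _ ha, Matrix.charmatrix_apply_ne _ _ _ this]
    · have : (⟨p, a⟩ : Σ p, d p) ≠ ⟨p', a'⟩ := fun h => hp (congrArg Sigma.fst h)
      simp [Matrix.charmatrix_apply_ne _ _ _ this, Matrix.blockDiagonal'_apply_ne _ _ _ hp]
  have ht : (Matrix.blockDiagonal' fun p => (M p).charmatrix).BlockTriangular Sigma.fst := by
    rintro ⟨p, a⟩ ⟨p', a'⟩ hlt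
    exact Matrix.blockDiagonal'_apply_ne _ _ _ (ne_of_gt hlt)
  rw [Matrix.charpoly, h]
  convert ht.det_fintype using 1
  refine Finset.prod_congr rfl fun p _ => ?_
  rw [Matrix.charpoly, ← Matrix.det_submatrix_equiv_self (Equiv.sigmaSubtype p)]
  congr 1
  ext ⟨⟨p₁, a⟩, h₁⟩ ⟨⟨p₂, b⟩, h₂⟩ : 1
  subst h₁
  obtain rfl : p₂ = p₁ := h₂
  simp [Matrix.toSquareBlock_def, Equiv.sigmaSubtype]

theorem qInt_mul_pred (q m : ℕ) : (qInt q m : ℝ) * (q - 1) = q ^ m - 1 := by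
  simpa [qInt] using geom_sum_mul (q : ℝ) m

theorem qInt_strictMono {q : ℕ} (hq : 1 < q) : StrictMono (qInt q) :=
  strictMono_nat_of_lt_succ fun m => by
    simpa [qInt, Finset.sum_range_succ] using Nat.pow_pos (n := m) (by lia : 0 < q)

/-- The square of the off-diagonal entry of `N(k, n-k, n)` in position `(k+a-1, k+a)`. -/
def offDiagSq (q n k a : ℕ) : ℕ := q ^ k * qInt q a * qInt q (n - 2 * k + 1 - a)

theorem offDiagSq_zero (q n k : ℕ) : offDiagSq q n k 0 = 0 := by simp [offDiagSq, qInt]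

theorem offDiagSq_top (q n k : ℕ) : offDiagSq q n k (n - 2 * k + 1) = 0 := by
  simp [offDiagSq, qInt]

theorem offDiagSq_pos {q n k a : ℕ} (hq : 1 < q) (ha : a < n - 2 * k) :
    0 < offDiagSq q n k (a + 1) := by
  have h := qInt_strictMono hq
  have h0 : ∀ m, 0 < m → 0 < qInt q m := fun m hm => lt_of_le_of_lt (Nat.zero_le _) (h hm)
  exact Nat.mul_pos (Nat.mul_pos (Nat.pow_pos (by lia)) (h0 _ (by lia))) (h0 _ (by lia))

theorem offDiagSq_succ {q n k a : ℕ} (hq : 1 < q) (hk : 2 * k ≤ n) (ha : a ≤ n - 2 * k) :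
    (offDiagSq q n k (a + 1) : ℝ) =
      offDiagSq q n k a + (qInt q (n - (k + a)) - qInt q (k + a)) := by
  obtain ⟨c, rfl⟩ : ∃ c, n = 2 * k + a + c := ⟨n - 2 * k - a, by lia⟩
  have hq' : (q : ℝ) - 1 ≠ 0 := by
    have : (1 : ℝ) < q := by exact_mod_cast hq
    linarith
  have e1 : 2 * k + a + c - 2 * k + 1 - (a + 1) = c := by lia
  have e2 : 2 * k + a + c - 2 * k + 1 - a = c + 1 := by lia
  have e3 : 2 * k + a + c - (k + a) = k + c := by lia
  have h := qInt_mul_pred q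
  have H : ∀ m, (qInt q m : ℝ) = (q ^ m - 1) / (q - 1) := fun m => by
    rw [← h, mul_div_cancel_right₀ _ hq']
  simp only [offDiagSq, e1, e2, e3]
  push_cast
  rw [H, H, H, H, H, H]
  field_simp
  ring

theorem Nent_self (q n k a : ℕ) :
    Nent q n k (k + a) (k + a) = (qInt q (k + a) + qInt q (n - (k + a)) : ℝ) := by
  simp [Nent]

theorem Nent_succ_left (q n k a : ℕ) :
    Nent q n k (k + (a + 1)) (k + a) = -√(offDiagSq q n k (a + 1)) := by
  have e1 : k + (a + 1) - k = a + 1 := by lia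
  have e2 : n - k + 1 - (k + (a + 1)) = n - 2 * k + 1 - (a + 1) := by lia
  rw [Nent, if_neg (by lia), if_neg (by lia), if_pos (by lia), e1, e2, offDiagSq]

theorem Nent_succ_right (q n k a : ℕ) :
    Nent q n k (k + a) (k + (a + 1)) = -√(offDiagSq q n k (a + 1)) := by
  have e1 : k + (a + 1) - k = a + 1 := by lia
  have e2 : n - k + 1 - (k + (a + 1)) = n - 2 * k + 1 - (a + 1) := by lia
  rw [Nent, if_neg (by lia), if_pos (by lia), e1, e2, offDiagSq]

theorem Nent_of_lt {q n k a b : ℕ} (h : a + 1 < b ∨ b + 1 < a) :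
    Nent q n k (k + a) (k + b) = 0 := by
  rw [Nent, if_neg (by lia), if_neg (by lia), if_neg (by lia)]

/-- Raising and lowering operators on a graded inner product space, adjoint to each other, whose
commutator acts on degree `j` as the scalar `[n-j]_q - [j]_q`. -/
structure IsLadder {V : Type*} [NormedAddCommGroup V] [InnerProductSpace ℝ V]
    (q n : ℕ) (G : ℕ → Submodule ℝ V) (U D : V →ₗ[ℝ] V) : Prop where
  ortho : ∀ i j, i ≠ j → ∀ x ∈ G i, ∀ y ∈ G j, inner ℝ x y = 0
  iSup_eq_top : ⨆ j, G j = ⊤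
  adj : ∀ x y, inner ℝ (U x) y = inner ℝ x (D y)
  up_mem : ∀ j, ∀ x ∈ G j, U x ∈ G (j + 1)
  down_mem : ∀ j, ∀ x ∈ G (j + 1), D x ∈ G j
  down_zero : ∀ x ∈ G 0, D x = 0
  comm : ∀ j, ∀ x ∈ G j, D (U x) = U (D x) + ((qInt q (n - j) : ℝ) - qInt q j) • x

/-- The normalized powers of the raising operator `U`, used on lowest vectors of degree `k`. -/
noncomputable def ladderMap {V : Type*} [NormedAddCommGroup V] [InnerProductSpace ℝ V]
    (q n : ℕ) (U : V →ₗ[ℝ] V) (k : ℕ) : ℕ → V →ₗ[ℝ] V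
  | 0 => LinearMap.id
  | a + 1 => (√(offDiagSq q n k (a + 1)))⁻¹ • U ∘ₗ ladderMap q n U k a

theorem ladderMap_succ_apply {V : Type*} [NormedAddCommGroup V] [InnerProductSpace ℝ V]
    (q n : ℕ) (U : V →ₗ[ℝ] V) (k a : ℕ) (x : V) :
    ladderMap q n U k (a + 1) x =
      (√(offDiagSq q n k (a + 1)))⁻¹ • U (ladderMap q n U k a x) := rfl

namespace IsLadder

variable {V : Type*} [NormedAddCommGroup V] [InnerProductSpace ℝ V]
  {q n : ℕ} {G : ℕ → Submodule ℝ V} {U D : V →ₗ[ℝ] V}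

theorem normSq_up (h : IsLadder q n G U D) {j : ℕ} {x : V} (hx : x ∈ G j) :
    ‖U x‖ ^ 2 = ‖D x‖ ^ 2 + ((qInt q (n - j) : ℝ) - qInt q j) * ‖x‖ ^ 2 := by
  rw [← real_inner_self_eq_norm_sq (U x), h.adj, h.comm j x hx, inner_add_right,
    real_inner_comm, h.adj, real_inner_smul_right, real_inner_self_eq_norm_sq,
    real_inner_self_eq_norm_sq]

theorem up_injOn (h : IsLadder q n G U D) (hq : 1 < q) {j : ℕ} (hj : 2 * j < n) {x : V}
    (hx : x ∈ G j) (hU : U x = 0) : x = 0 := by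
  have h1 := h.normSq_up hx
  have h2 : (qInt q j : ℝ) < qInt q (n - j) := by
    exact_mod_cast qInt_strictMono hq (by lia)
  rw [hU, norm_zero] at h1
  by_contra hne
  have : 0 < ((qInt q (n - j) : ℝ) - qInt q j) * ‖x‖ ^ 2 :=
    mul_pos (by linarith) (pow_pos (norm_pos_iff.2 hne) 2)
  nlinarith [sq_nonneg ‖D x‖]

theorem down_injOn (h : IsLadder q n G U D) (hq : 1 < q) {j : ℕ} (hj : n < 2 * j) {x : V}
    (hx : x ∈ G j) (hD : D x = 0) : x = 0 := by
  have h1 := h.normSq_up hx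
  have h2 : (qInt q (n - j) : ℝ) < qInt q j := by
    exact_mod_cast qInt_strictMono hq (by lia)
  rw [hD, norm_zero] at h1
  by_contra hne
  have : 0 < ((qInt q j : ℝ) - qInt q (n - j)) * ‖x‖ ^ 2 :=
    mul_pos (by linarith) (pow_pos (norm_pos_iff.2 hne) 2)
  nlinarith [sq_nonneg ‖U x‖]

theorem orthogonal_map_up_inf (h : IsLadder q n G U D) (j : ℕ) :
    ((G j).map U)ᗮ ⊓ G (j + 1) = G (j + 1) ⊓ LinearMap.ker D := by
  ext z
  simp only [Submodule.mem_inf, LinearMap.mem_ker, Submodule.mem_orthogonal, Submodule.mem_map,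
    forall_exists_index, and_imp, forall_apply_eq_imp_iff₂, h.adj]
  constructor
  · rintro ⟨h1, h2⟩
    exact ⟨h2, inner_self_eq_zero.1 (h1 _ (h.down_mem _ _ h2))⟩
  · rintro ⟨h1, h2⟩
    exact ⟨fun a _ => by rw [h2, inner_zero_right], h1⟩

theorem finrank_lowest [FiniteDimensional ℝ V] (h : IsLadder q n G U D) (hq : 1 < q) {k : ℕ}
    (hk : 2 * k ≤ n) :
    Module.finrank ℝ (G k ⊓ LinearMap.ker D : Submodule ℝ V) =
      Module.finrank ℝ (G k) - if k = 0 then 0 else Module.finrank ℝ (G (k - 1)) := by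
  cases k with
  | zero =>
    have : G 0 ⊓ LinearMap.ker D = G 0 := inf_eq_left.2 fun x hx => h.down_zero x hx
    rw [this, if_pos rfl, Nat.sub_zero]
  | succ k =>
    have hle : (G k).map U ≤ G (k + 1) := Submodule.map_le_iff_le_comap.2 (h.up_mem k)
    have h1 := Submodule.finrank_add_inf_finrank_orthogonal hle
    rw [h.orthogonal_map_up_inf] at h1
    have h2 : Module.finrank ℝ ((G k).map U) = Module.finrank ℝ (G k) := by
      rw [← LinearMap.range_domRestrict]
      refine LinearMap.finrank_range_of_inj ?_
      rw [← LinearMap.ker_eq_bot, LinearMap.ker_eq_bot']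
      rintro ⟨x, hx⟩ hU
      exact Subtype.ext (h.up_injOn hq (by lia) hx hU)
    rw [if_neg k.succ_ne_zero, Nat.add_sub_cancel]
    lia

theorem ladderMap_mem (h : IsLadder q n G U D) {k : ℕ} {x : V} (hx : x ∈ G k) (a : ℕ) :
    ladderMap q n U k a x ∈ G (k + a) := by
  induction a with
  | zero => exact hx
  | succ a ih => exact (G (k + a + 1)).smul_mem _ (h.up_mem _ _ ih)

theorem up_ladderMap_of_lt (hq : 1 < q) {k a : ℕ} (ha : a < n - 2 * k) (x : V) :
    U (ladderMap q n U k a x) = √(offDiagSq q n k (a + 1)) • ladderMap q n U k (a + 1) x := by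
  have : √(offDiagSq q n k (a + 1) : ℝ) ≠ 0 :=
    (Real.sqrt_pos.2 (by exact_mod_cast offDiagSq_pos hq ha)).ne'
  simp [ladderMap, smul_smul, this]

theorem down_up_ladderMap (h : IsLadder q n G U D) (hq : 1 < q) {k : ℕ} (hk : 2 * k ≤ n) {x : V}
    (hx : x ∈ G k) (hD : D x = 0) {a : ℕ} (ha : a ≤ n - 2 * k) :
    D (U (ladderMap q n U k a x)) = (offDiagSq q n k (a + 1) : ℝ) • ladderMap q n U k a x := by
  rw [h.comm _ _ (h.ladderMap_mem hx a), offDiagSq_succ hq hk ha, add_smul, add_left_inj]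
  induction a with
  | zero => simp [ladderMap, hD, offDiagSq_zero]
  | succ a ih =>
    have h1 := h.comm _ _ (h.ladderMap_mem hx a)
    rw [ih (by lia), ← add_smul, ← offDiagSq_succ hq hk (by lia)] at h1
    rw [ladderMap_succ_apply, map_smul, h1, map_smul, map_smul, smul_comm]

theorem up_ladderMap (h : IsLadder q n G U D) (hq : 1 < q) {k : ℕ} (hk : 2 * k ≤ n) {x : V}
    (hx : x ∈ G k) (hD : D x = 0) {a : ℕ} (ha : a ≤ n - 2 * k) :
    U (ladderMap q n U k a x) = √(offDiagSq q n k (a + 1)) • ladderMap q n U k (a + 1) x := by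
  rcases ha.lt_or_eq with ha | rfl
  · exact up_ladderMap_of_lt hq ha x
  · have h1 := h.down_up_ladderMap hq hk hx hD le_rfl
    rw [offDiagSq_top] at h1 ⊢
    have : U (ladderMap q n U k (n - 2 * k) x) = 0 := by
      rw [← inner_self_eq_zero (𝕜 := ℝ), h.adj, h1]
      simp
    simp [this]

theorem down_ladderMap_succ (h : IsLadder q n G U D) (hq : 1 < q) {k : ℕ} (hk : 2 * k ≤ n) {x : V}
    (hx : x ∈ G k) (hD : D x = 0) {a : ℕ} (ha : a < n - 2 * k) :
    D (ladderMap q n U k (a + 1) x) = √(offDiagSq q n k (a + 1)) • ladderMap q n U k a x := by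
  have hpos : (0 : ℝ) < offDiagSq q n k (a + 1) := by exact_mod_cast offDiagSq_pos hq ha
  rw [ladderMap_succ_apply, map_smul, h.down_up_ladderMap hq hk hx hD ha.le, smul_smul]
  congr 1
  rw [inv_mul_eq_iff_eq_mul₀ (Real.sqrt_pos.2 hpos).ne', Real.mul_self_sqrt hpos.le]

theorem inner_ladderMap_succ (h : IsLadder q n G U D) (k a : ℕ) (x z : V) :
    inner ℝ (ladderMap q n U k (a + 1) x) z =
      (√(offDiagSq q n k (a + 1)))⁻¹ * inner ℝ (ladderMap q n U k a x) (D z) := by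
  rw [ladderMap_succ_apply, real_inner_smul_left, h.adj]

theorem inner_ladderMap_of_lt (h : IsLadder q n G U D) (hq : 1 < q) {k l : ℕ} (hl : 2 * l ≤ n)
    (x : V) {y : V} (hy : y ∈ G l) (hD : D y = 0) {a b : ℕ} (hb : b ≤ n - 2 * l) (hab : b < a) :
    inner ℝ (ladderMap q n U k a x) (ladderMap q n U l b y) = 0 := by
  induction b generalizing a with
  | zero =>
    obtain ⟨a, rfl⟩ : ∃ a', a = a' + 1 := ⟨a - 1, by lia⟩
    rw [h.inner_ladderMap_succ, ladderMap, LinearMap.id_apply, hD, inner_zero_right, mul_zero]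
  | succ b ih =>
    obtain ⟨a, rfl⟩ : ∃ a', a = a' + 1 := ⟨a - 1, by lia⟩
    rw [h.inner_ladderMap_succ, h.down_ladderMap_succ hq hl hy hD (by lia), real_inner_smul_right,
      ih (by lia) (by lia), mul_zero, mul_zero]

theorem inner_ladderMap_self (h : IsLadder q n G U D) (hq : 1 < q) {k : ℕ} (hk : 2 * k ≤ n)
    (x : V) {y : V} (hy : y ∈ G k) (hD : D y = 0) {a : ℕ} (ha : a ≤ n - 2 * k) :
    inner ℝ (ladderMap q n U k a x) (ladderMap q n U k a y) = inner ℝ x y := by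
  induction a with
  | zero => rfl
  | succ a ih =>
    have hpos : (0 : ℝ) < offDiagSq q n k (a + 1) := by exact_mod_cast offDiagSq_pos hq ha
    rw [h.inner_ladderMap_succ, h.down_ladderMap_succ hq hk hy hD (by lia), real_inner_smul_right,
      ih (by lia), ← mul_assoc, inv_mul_cancel₀ (Real.sqrt_pos.2 hpos).ne', one_mul]

theorem sum_Nent_smul_ladderMap (h : IsLadder q n G U D) (hq : 1 < q) {k : ℕ} (hk : 2 * k ≤ n)
    {x : V} (hx : x ∈ G k) (hD : D x = 0) {a : ℕ} (ha : a ≤ n - 2 * k) :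
    ∑ b : Fin (n - 2 * k + 1), Nent q n k (k + b) (k + a) • ladderMap q n U k b x =
      (qInt q (k + a) + qInt q (n - (k + a)) : ℝ) • ladderMap q n U k a x
        - U (ladderMap q n U k a x) - D (ladderMap q n U k a x) := by
  have hup : U (ladderMap q n U k a x) = -∑ b ∈ Finset.range (n - 2 * k + 1),
      if b = a + 1 then Nent q n k (k + b) (k + a) • ladderMap q n U k b x else 0 := by
    rw [h.up_ladderMap hq hk hx hD ha, Finset.sum_ite_eq']
    split_ifs with hb
    · rw [Nent_succ_left, neg_smul, neg_neg]
    · obtain rfl : a = n - 2 * k := by simp at hb; lia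
      simp [offDiagSq_top]
  have hdown : D (ladderMap q n U k a x) = -∑ b ∈ Finset.range (n - 2 * k + 1),
      if b + 1 = a then Nent q n k (k + b) (k + a) • ladderMap q n U k b x else 0 := by
    cases a with
    | zero => simp [ladderMap, hD]
    | succ a =>
      simp only [Nat.add_right_cancel_iff]
      rw [h.down_ladderMap_succ hq hk hx hD ha, Finset.sum_ite_eq', if_pos (by simp; lia),
        Nent_succ_right, neg_smul, neg_neg]
  have hself : (qInt q (k + a) + qInt q (n - (k + a)) : ℝ) • ladderMap q n U k a x =
      ∑ b ∈ Finset.range (n - 2 * k + 1),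
        if b = a then Nent q n k (k + b) (k + a) • ladderMap q n U k b x else 0 := by
    rw [Finset.sum_ite_eq', if_pos (by simp; lia), Nent_self]
  rw [hself, hup, hdown, sub_neg_eq_add, sub_neg_eq_add, ← Finset.sum_add_distrib,
    ← Finset.sum_add_distrib,
    Fin.sum_univ_eq_sum_range fun b => Nent q n k (k + b) (k + a) • ladderMap q n U k b x]
  refine Finset.sum_congr rfl fun b _ => ?_
  rcases lt_trichotomy b a with hb | hb | hb
  · by_cases hb' : b + 1 = a
    · simp [hb.ne, hb', show b ≠ a + 1 by lia]
    · simp [hb.ne, hb', show b ≠ a + 1 by lia, Nent_of_lt (show b + 1 < a ∨ a + 1 < b by lia)]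
  · simp [hb]
  · by_cases hb' : b = a + 1
    · simp [hb']
      lia
    · simp [hb.ne', hb', show b + 1 ≠ a by lia,
        Nent_of_lt (show b + 1 < a ∨ a + 1 < b by lia)]

/-- Index set of the lowest vectors: a degree `k ≤ n / 2` and an element of a basis of the space of
degree `k` vectors killed by `D`. -/
abbrev LowestIndex (n : ℕ) (G : ℕ → Submodule ℝ V) (D : V →ₗ[ℝ] V) : Type :=
  Σ k : Fin (n / 2 + 1), Fin (Module.finrank ℝ (G k ⊓ LinearMap.ker D : Submodule ℝ V))

theorem LowestIndex.two_mul_le (p : LowestIndex n G D) : 2 * (p.1 : ℕ) ≤ n := by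
  have := p.1.2
  lia

section Basis

variable [FiniteDimensional ℝ V]

/-- An orthonormal basis of the lowest vectors of each degree. -/
noncomputable def lowestVec (n : ℕ) (G : ℕ → Submodule ℝ V) (D : V →ₗ[ℝ] V)
    (p : LowestIndex n G D) : V :=
  stdOrthonormalBasis ℝ (G p.1 ⊓ LinearMap.ker D : Submodule ℝ V) p.2

theorem lowestVec_mem (p : LowestIndex n G D) : lowestVec n G D p ∈ G p.1 :=
  (stdOrthonormalBasis ℝ (G p.1 ⊓ LinearMap.ker D : Submodule ℝ V) p.2).2.1

theorem down_lowestVec (p : LowestIndex n G D) : D (lowestVec n G D p) = 0 :=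
  (stdOrthonormalBasis ℝ (G p.1 ⊓ LinearMap.ker D : Submodule ℝ V) p.2).2.2

theorem orthonormal_lowestVec (h : IsLadder q n G U D) : Orthonormal ℝ (lowestVec n G D) := by
  rw [orthonormal_iff_ite]
  rintro ⟨k, i⟩ ⟨l, j⟩
  by_cases hkl : k = l
  · subst hkl
    have := orthonormal_iff_ite.1
      (stdOrthonormalBasis ℝ (G k ⊓ LinearMap.ker D : Submodule ℝ V)).orthonormal i j
    simpa [lowestVec] using this
  · rw [if_neg fun e => hkl (congrArg Sigma.fst e)]
    exact h.ortho _ _ (fun e => hkl (Fin.ext e)) _ (lowestVec_mem ⟨k, i⟩) _ (lowestVec_mem ⟨l, j⟩)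

/-- The vectors of the Jordan-type basis adapted to the ladder. -/
noncomputable def ladderVec (q n : ℕ) (G : ℕ → Submodule ℝ V) (U D : V →ₗ[ℝ] V)
    (s : Σ p : LowestIndex n G D, Fin (n - 2 * (p.1 : ℕ) + 1)) : V :=
  ladderMap q n U s.1.1 s.2 (lowestVec n G D s.1)

theorem orthonormal_ladderVec (h : IsLadder q n G U D) (hq : 1 < q) :
    Orthonormal ℝ (ladderVec q n G U D) := by
  rw [orthonormal_iff_ite]
  rintro ⟨p, a⟩ ⟨p', b⟩
  have hp := p.two_mul_le
  have hp' := p'.two_mul_le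
  rcases lt_trichotomy (a : ℕ) b with hab | hab | hab
  · rw [if_neg (by rintro ⟨⟩; exact hab.false), real_inner_comm]
    exact h.inner_ladderMap_of_lt hq hp _ (lowestVec_mem p) (down_lowestVec p) (by lia) hab
  · by_cases hk : p.1 = p'.1
    · have h1 := h.inner_ladderMap_self hq hp' (lowestVec n G D p) (lowestVec_mem p')
        (down_lowestVec p') (a := b) (by lia)
      have h2 := orthonormal_iff_ite.1 h.orthonormal_lowestVec p p'
      have h3 : (⟨p, a⟩ : Σ p : LowestIndex n G D, Fin (n - 2 * (p.1 : ℕ) + 1)) = ⟨p', b⟩ ↔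
          p = p' := by
        refine ⟨fun e => congrArg Sigma.fst e, ?_⟩
        rintro rfl
        rw [Fin.ext hab]
      simp only [ladderVec, hab, hk, h1, h2, h3]
    · rw [if_neg (by rintro ⟨⟩; exact hk rfl)]
      refine h.ortho (p.1 + a) (p'.1 + b) (fun e => hk (Fin.ext (by lia))) _
        (h.ladderMap_mem (lowestVec_mem p) _) _ (h.ladderMap_mem (lowestVec_mem p') _)
  · rw [if_neg (by rintro ⟨⟩; exact hab.false)]
    exact h.inner_ladderMap_of_lt hq hp' _ (lowestVec_mem p') (down_lowestVec p') (by lia) hab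

theorem up_mem_span_ladderVec (h : IsLadder q n G U D) (hq : 1 < q) {x : V}
    (hx : x ∈ Submodule.span ℝ (Set.range (ladderVec q n G U D))) :
    U x ∈ Submodule.span ℝ (Set.range (ladderVec q n G U D)) := by
  induction hx using Submodule.span_induction with
  | zero => simp
  | add x y _ _ hx hy => simpa using add_mem hx hy
  | smul c x _ hx => simpa using Submodule.smul_mem _ c hx
  | mem x hx =>
    obtain ⟨⟨p, a⟩, rfl⟩ := hx
    have hU := h.up_ladderMap hq p.two_mul_le (lowestVec_mem p) (down_lowestVec p) (a := a)
      (by lia)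
    rw [ladderVec, hU]
    rcases (Nat.lt_succ_iff.1 a.2).lt_or_eq with ha | ha
    · exact Submodule.smul_mem _ _ (Submodule.subset_span ⟨⟨p, ⟨a + 1, by lia⟩⟩, rfl⟩)
    · simp only [ha, offDiagSq_top]
      simp

theorem lowest_le_span_ladderVec (h : IsLadder q n G U D) (hq : 1 < q) (k : ℕ) :
    G k ⊓ LinearMap.ker D ≤ Submodule.span ℝ (Set.range (ladderVec q n G U D)) := by
  intro x hx
  rcases lt_or_ge n (2 * k) with hk | hk
  · rw [h.down_injOn hq hk hx.1 hx.2]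
    exact zero_mem _
  · let K : Fin (n / 2 + 1) := ⟨k, by lia⟩
    have h1 := (stdOrthonormalBasis ℝ (G k ⊓ LinearMap.ker D : Submodule ℝ V)).sum_repr ⟨x, hx⟩
    have h2 := congrArg Subtype.val h1
    rw [← show _ = x from h2, Submodule.coe_sum]
    refine Submodule.sum_mem _ fun i _ => Submodule.smul_mem _ _ (Submodule.subset_span ?_)
    exact ⟨⟨⟨K, i⟩, 0⟩, rfl⟩

theorem span_ladderVec (h : IsLadder q n G U D) (hq : 1 < q) :
    Submodule.span ℝ (Set.range (ladderVec q n G U D)) = ⊤ := by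
  rw [eq_top_iff, ← h.iSup_eq_top]
  refine iSup_le fun j => ?_
  induction j with
  | zero => exact fun x hx => h.lowest_le_span_ladderVec hq 0 ⟨hx, h.down_zero x hx⟩
  | succ j ih =>
    intro x hx
    obtain ⟨y, hy, z, hz, rfl⟩ := ((G j).map U).exists_add_mem_mem_orthogonal x
    obtain ⟨y, hy, rfl⟩ := hy
    have hz' : z ∈ G (j + 1) := by simpa using sub_mem hx (h.up_mem j y hy)
    refine add_mem (h.up_mem_span_ladderVec hq (ih hy)) (h.lowest_le_span_ladderVec hq (j + 1) ?_)
    rw [← h.orthogonal_map_up_inf]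
    exact ⟨hz, hz'⟩

/-- The characteristic polynomial of the Laplacian-type operator attached to a ladder. -/
theorem charpoly_eq (h : IsLadder q n G U D) (hq : 1 < q) {L : V →ₗ[ℝ] V}
    (hL : ∀ j, ∀ x ∈ G j, L x = (qInt q j + qInt q (n - j) : ℝ) • x - U x - D x) :
    L.charpoly = ∏ k ∈ Finset.range (n / 2 + 1),
      (Matrix.of fun a b : Fin (n - 2 * k + 1) =>
          Nent q n k (k + (a : ℕ)) (k + (b : ℕ))).charpoly ^
        (Module.finrank ℝ (G k) - if k = 0 then 0 else Module.finrank ℝ (G (k - 1))) := by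
  classical
  let B := Module.Basis.mk (h.orthonormal_ladderVec hq).linearIndependent
    (h.span_ladderVec hq).ge
  let N : ∀ k : ℕ, Matrix (Fin (n - 2 * k + 1)) (Fin (n - 2 * k + 1)) ℝ := fun k =>
    Matrix.of fun a b => Nent q n k (k + (a : ℕ)) (k + (b : ℕ))
  have hmat : LinearMap.toMatrix B B L =
      Matrix.blockDiagonal' fun p : LowestIndex n G D => N p.1 := by
    rw [← LinearMap.toMatrix_toLin B B (Matrix.blockDiagonal' _)]
    congr 1
    refine B.ext fun ⟨p, a⟩ => ?_
    have hB : ∀ s, B s = ladderVec q n G U D s := fun s => by simp [B]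
    rw [Matrix.toLin_self, Fintype.sum_sigma, Finset.sum_eq_single p]
    · simp only [hB, Matrix.blockDiagonal'_apply_eq]
      exact (hL _ _ (h.ladderMap_mem (lowestVec_mem p) a)).trans
        (h.sum_Nent_smul_ladderMap hq p.two_mul_le (lowestVec_mem p) (down_lowestVec p)
          (by lia)).symm
    · intro p' _ hp
      simp [Matrix.blockDiagonal'_apply_ne _ _ _ hp]
    · simp
  rw [← LinearMap.charpoly_toMatrix L B, hmat, Matrix.charpoly_blockDiagonal',
    Fintype.prod_sigma, Finset.prod_range]
  refine Finset.prod_congr rfl fun k _ => ?_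
  rw [← h.finrank_lowest hq (by lia)]
  exact (Finset.prod_const (N k).charpoly).trans (by rw [Finset.card_univ, Fintype.card_fin])

end Basis

end IsLadder

section Counting

variable {F V : Type*} [Field F] [AddCommGroup V] [Module F V]

theorem card_finrank_eq_one [Finite F] :
    Nat.card {H : Submodule F V // Module.finrank F H = 1} =
      qInt (Nat.card F) (Module.finrank F V) := by
  rw [← Nat.card_congr (Projectivization.equivSubmodule F V)]
  exact Projectivization.card_of_finrank F V rfl

variable [FiniteDimensional F V]

theorem Submodule.finrank_comap_mkQ (X : Submodule F V) (H : Submodule F (V ⧸ X)) :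
    Module.finrank F (H.comap X.mkQ) = Module.finrank F X + Module.finrank F H := by
  have h := LinearMap.finrank_range_add_finrank_ker (X.mkQ.domRestrict (H.comap X.mkQ))
  have hX : X ≤ H.comap X.mkQ := Submodule.le_comap_mkQ X H
  rw [LinearMap.range_domRestrict, Submodule.map_comap_eq_self (by simp), LinearMap.ker_domRestrict,
    Submodule.ker_mkQ, (Submodule.comapSubtypeEquivOfLe hX).finrank_eq] at h
  lia

theorem card_upper_covers [Finite F] (X : Submodule F V) :
    Nat.card {Y : Submodule F V // X ≤ Y ∧ Module.finrank F Y = Module.finrank F X + 1} =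
      qInt (Nat.card F) (Module.finrank F V - Module.finrank F X) := by
  rw [← X.finrank_quotient, ← card_finrank_eq_one]
  refine (Nat.card_congr ?_).symm
  refine (X.comapMkQRelIso.toEquiv.subtypeEquiv
    (q := fun Y : Set.Ici X => Module.finrank F (Y : Submodule F V) = Module.finrank F X + 1)
    fun H => ?_).trans
    (Equiv.subtypeSubtypeEquivSubtypeInter (fun Y => X ≤ Y)
      fun Y => Module.finrank F Y = Module.finrank F X + 1)
  have := X.finrank_comap_mkQ H
  change _ ↔ Module.finrank F (H.comap X.mkQ) = _
  lia

theorem card_lower_covers [Finite F] (Y : Submodule F V) :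
    Nat.card {X : Submodule F V // X ≤ Y ∧ Module.finrank F Y = Module.finrank F X + 1} =
      qInt (Nat.card F) (Module.finrank F Y) := by
  rw [← Subspace.dual_finrank_eq (K := F) (V := Y), ← card_finrank_eq_one,
    Subspace.dual_finrank_eq]
  refine Nat.card_congr (Equiv.symm ?_)
  refine ((Subspace.orderIsoFiniteDimensional.toEquiv.trans OrderDual.ofDual).symm.trans
    Y.mapIic.toEquiv |>.subtypeEquiv
    (q := fun X : Set.Iic Y =>
      Module.finrank F Y = Module.finrank F (X : Submodule F V) + 1) fun H => ?_).trans
    (Equiv.subtypeSubtypeEquivSubtypeInter (fun X => X ≤ Y)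
      fun X => Module.finrank F Y = Module.finrank F X + 1)
  have h1 := Subspace.finrank_add_finrank_dualCoannihilator_eq H
  have h2 := Y.finrank_map_subtype_eq H.dualCoannihilator
  change _ ↔ _ = Module.finrank F (H.dualCoannihilator.map Y.subtype) + 1
  lia

/-- Two distinct subspaces have a common upper cover iff they have a common lower cover, and both
are then unique. -/
theorem card_common_covers {X X' : Submodule F V} (hne : X ≠ X') :
    Nat.card {Y : Submodule F V // (X ≤ Y ∧ Module.finrank F Y = Module.finrank F X + 1) ∧
        (X' ≤ Y ∧ Module.finrank F Y = Module.finrank F X' + 1)} =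
      Nat.card {Z : Submodule F V // (Z ≤ X ∧ Module.finrank F X = Module.finrank F Z + 1) ∧
        (Z ≤ X' ∧ Module.finrank F X' = Module.finrank F Z + 1)} := by
  have hdim := Submodule.finrank_sup_add_finrank_inf_eq X X'
  have hsup : Module.finrank F X = Module.finrank F X' →
      Module.finrank F X < Module.finrank F (X ⊔ X' : Submodule F V) := fun he =>
    Submodule.finrank_lt_finrank_of_lt <| lt_of_le_of_ne le_sup_left fun e =>
      hne (Submodule.eq_of_le_of_finrank_eq (e ▸ le_sup_right : X' ≤ X) he.symm).symm
  refine Nat.card_congr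
    { toFun := fun Y => ⟨X ⊓ X', ?_⟩, invFun := fun Z => ⟨X ⊔ X', ?_⟩,
      left_inv := fun Y => ?_, right_inv := fun Z => ?_ }
  · obtain ⟨Y, ⟨h1, h2⟩, h3, h4⟩ := Y
    have := Submodule.finrank_mono (sup_le h1 h3)
    have := hsup (by lia)
    exact ⟨⟨inf_le_left, by lia⟩, inf_le_right, by lia⟩
  · obtain ⟨Z, ⟨h1, h2⟩, h3, h4⟩ := Z
    have := Submodule.finrank_mono (le_inf h1 h3)
    have := hsup (by lia)
    exact ⟨⟨le_sup_left, by lia⟩, le_sup_right, by lia⟩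
  · obtain ⟨Y, ⟨h1, h2⟩, h3, h4⟩ := Y
    have := hsup (by lia)
    exact Subtype.ext (Submodule.eq_of_le_of_finrank_le (sup_le h1 h3) (by lia))
  · obtain ⟨Z, ⟨h1, h2⟩, h3, h4⟩ := Z
    have := hsup (by lia)
    exact Subtype.ext (Submodule.eq_of_le_of_finrank_le (le_inf h1 h3) (by lia)).symm

end Counting

section Cube

variable (F : Type) [Field F] [Fintype F] (n : ℕ)

open scoped Classical in
/-- The matrix of the raising operator: its `(Y, X)` entry is `1` if `Y` covers `X`. -/
noncomputable def upMatrix : Matrix (Submodule F (Fin n → F)) (Submodule F (Fin n → F)) ℝ :=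
  Matrix.of fun Y X => if X ≤ Y ∧ Module.finrank F Y = Module.finrank F X + 1 then 1 else 0

open scoped Classical in
theorem transpose_upMatrix_mul_upMatrix :
    (upMatrix F n).transpose * upMatrix F n = upMatrix F n * (upMatrix F n).transpose +
      Matrix.diagonal fun X : Submodule F (Fin n → F) =>
        (qInt (Fintype.card F) (n - Module.finrank F X) : ℝ) -
        qInt (Fintype.card F) (Module.finrank F X) := by
  ext X X'
  simp only [Matrix.mul_apply, Matrix.add_apply, Matrix.transpose_apply, upMatrix, Matrix.of_apply,
    ite_zero_mul_ite_zero, mul_one]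
  by_cases hne : X = X'
  · subst hne
    have h1 := card_upper_covers X
    have h2 := card_lower_covers X
    rw [Nat.card_eq_fintype_card, Fintype.card_subtype, Module.finrank_fin_fun,
      Nat.card_eq_fintype_card] at h1
    rw [Nat.card_eq_fintype_card, Fintype.card_subtype, Nat.card_eq_fintype_card] at h2
    simp [← h1, ← h2]
  · have h := card_common_covers hne
    rw [Nat.card_eq_fintype_card, Nat.card_eq_fintype_card, Fintype.card_subtype,
      Fintype.card_subtype] at h
    simp [hne, h]

open scoped Classical in
theorem lapMatrix_vsCube :
    (vsCube F n).lapMatrix ℝ =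
      Matrix.diagonal (fun X : Submodule F (Fin n → F) =>
        (qInt (Fintype.card F) (Module.finrank F X) : ℝ) +
        qInt (Fintype.card F) (n - Module.finrank F X)) -
      upMatrix F n - (upMatrix F n).transpose := by
  have hadj : ∀ X Y, (if (vsCube F n).Adj X Y then (1 : ℝ) else 0) =
      upMatrix F n X Y + upMatrix F n Y X := by
    intro X Y
    simp only [vsCube, SimpleGraph.fromRel_adj, upMatrix, Matrix.of_apply]
    by_cases h1 : X ≤ Y ∧ Module.finrank F Y = Module.finrank F X + 1
    · have hne : X ≠ Y := by rintro rfl; lia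
      have h2 : ¬(Y ≤ X ∧ Module.finrank F X = Module.finrank F Y + 1) := by lia
      rw [if_pos ⟨hne, Or.inl h1⟩, if_neg h2, if_pos h1, zero_add]
    · by_cases h2 : Y ≤ X ∧ Module.finrank F X = Module.finrank F Y + 1
      · have hne : X ≠ Y := by rintro rfl; lia
        rw [if_pos ⟨hne, Or.inr h2⟩, if_pos h2, if_neg h1, add_zero]
      · simp [h1, h2]
  have hdeg : ∀ X, ((vsCube F n).degree X : ℝ) =
      (qInt (Fintype.card F) (Module.finrank F X) : ℝ) +
        qInt (Fintype.card F) (n - Module.finrank F X) := by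
    intro X
    have h1 := card_upper_covers X
    have h2 := card_lower_covers X
    rw [Nat.card_eq_fintype_card, Fintype.card_subtype, Module.finrank_fin_fun,
      Nat.card_eq_fintype_card] at h1
    rw [Nat.card_eq_fintype_card, Fintype.card_subtype, Nat.card_eq_fintype_card] at h2
    rw [SimpleGraph.degree_eq_sum_if_adj, Finset.sum_congr rfl fun Y _ => hadj X Y,
      Finset.sum_add_distrib, ← h1, ← h2]
    simp [upMatrix]
  ext X Y
  rw [SimpleGraph.lapMatrix, Matrix.sub_apply, SimpleGraph.adjMatrix_apply, hadj,
    SimpleGraph.degMatrix, Matrix.sub_apply, Matrix.sub_apply, Matrix.transpose_apply, sub_sub]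
  simp only [hdeg]

/-- The functions supported on the subspaces of dimension `j`. -/
def rankPart (j : ℕ) : Submodule ℝ (EuclideanSpace ℝ (Submodule F (Fin n → F))) where
  carrier := {f | ∀ X : Submodule F (Fin n → F), Module.finrank F X ≠ j → f X = 0}
  zero_mem' := by simp
  add_mem' hf hg X hX := by simp [hf X hX, hg X hX]
  smul_mem' c f hf X hX := by simp [hf X hX]

theorem finrank_rankPart (j : ℕ) : Module.finrank ℝ (rankPart F n j) = gauss F n j := by
  classical
  let e : rankPart F n j ≃ₗ[ℝ]
      ({X : Submodule F (Fin n → F) // Module.finrank F X = j} → ℝ) :=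
    { toFun := fun f X => f.1 X.1
      map_add' := fun _ _ => rfl
      map_smul' := fun _ _ => rfl
      invFun := fun g => ⟨WithLp.toLp 2 fun X => if h : Module.finrank F X = j then g ⟨X, h⟩ else 0,
        fun X hX => by simp [hX]⟩
      left_inv := fun f => by
        ext X
        by_cases hX : Module.finrank F X = j
        · simp [hX]
        · simp [hX, f.2 X hX]
      right_inv := fun g => by
        ext X
        simp [X.2] }
  rw [e.finrank_eq, Module.finrank_fintype_fun_eq_card, gauss, Nat.card_eq_fintype_card]

open scoped Classical in
theorem isLadder_rankPart :
    IsLadder (Fintype.card F) n (rankPart F n) (Matrix.toEuclideanLin (upMatrix F n))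
      (Matrix.toEuclideanLin (upMatrix F n).transpose) where
  ortho i j hij x hx y hy := by
    rw [PiLp.inner_apply]
    refine Finset.sum_eq_zero fun X _ => ?_
    by_cases hX : Module.finrank F X = i
    · simp [hy X (by lia)]
    · simp [hx X hX]
  iSup_eq_top := by
    rw [eq_top_iff]
    intro f _
    rw [← (EuclideanSpace.basisFun _ ℝ).sum_repr f]
    refine Submodule.sum_mem _ fun X _ => Submodule.smul_mem _ _ ?_
    refine Submodule.mem_iSup_of_mem (Module.finrank F X) fun Y hY => ?_
    have : Y ≠ X := by rintro rfl; exact hY rfl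
    simp [this]
  adj x y := by
    have := Matrix.toEuclideanLin_conjTranspose_eq_adjoint (upMatrix F n)
    rw [Matrix.conjTranspose_eq_transpose_of_trivial] at this
    rw [this, LinearMap.adjoint_inner_right]
  up_mem j x hx Y hY := by
    change ∑ X, _ = _
    refine Finset.sum_eq_zero fun X _ => ?_
    by_cases hX : Module.finrank F X = j
    · have : ¬(X ≤ Y ∧ Module.finrank F Y = Module.finrank F X + 1) := by lia
      simp [upMatrix, this]
    · simp [hx X hX]
  down_mem j x hx Y hY := by
    change ∑ X, _ = _
    refine Finset.sum_eq_zero fun X _ => ?_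
    by_cases hX : Module.finrank F X = j + 1
    · have : ¬(Y ≤ X ∧ Module.finrank F X = Module.finrank F Y + 1) := by lia
      simp [upMatrix, this]
    · simp [hx X hX]
  down_zero x hx := by
    ext Y
    change ∑ X, _ = _
    refine Finset.sum_eq_zero fun X _ => ?_
    by_cases hX : Module.finrank F X = 0
    · have : ¬(Y ≤ X ∧ Module.finrank F X = Module.finrank F Y + 1) := by lia
      simp [upMatrix, this]
    · simp [hx X hX]
  comm j x hx := by
    have h := congrArg (fun M : Matrix _ _ ℝ => M.mulVec x.ofLp)
      (transpose_upMatrix_mul_upMatrix F n)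
    simp only [Matrix.add_mulVec, ← Matrix.mulVec_mulVec] at h
    ext X
    have hX := congrFun h X
    refine hX.trans ?_
    simp only [Pi.add_apply, Matrix.mulVec_diagonal]
    by_cases hj : Module.finrank F X = j
    · subst hj; rfl
    · simp [hx X hj]

end Cube

open scoped Classical in
/-- The characteristic polynomial of the Laplacian of `C_{F_q}(n)` is the product, over
`0 ≤ k ≤ n/2`, of the characteristic polynomial of the block `N(k, n-k, n)` raised to the
multiplicity `[n choose k]_q - [n choose k-1]_q`. -/
theorem charpoly_lapMatrix_vsCube (q n : ℕ) (hq : IsPrimePow q) (hn : 1 ≤ n)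
    (F : Type) [Field F] [Fintype F] (hF : Fintype.card F = q) :
    ((vsCube F n).lapMatrix ℝ).charpoly =
      ∏ k ∈ Finset.range (n / 2 + 1),
        (Matrix.of fun a b : Fin (n - 2 * k + 1) =>
            Nent q n k (k + (a : ℕ)) (k + (b : ℕ))).charpoly ^ gaussDiff F n k := by
  subst hF
  have hL : ∀ j, ∀ x ∈ rankPart F n j,
      Matrix.toEuclideanLin ((vsCube F n).lapMatrix ℝ) x =
        (qInt (Fintype.card F) j + qInt (Fintype.card F) (n - j) : ℝ) • x -
          Matrix.toEuclideanLin (upMatrix F n) x -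
          Matrix.toEuclideanLin (upMatrix F n).transpose x := by
    intro j x hx
    rw [lapMatrix_vsCube, map_sub, map_sub, LinearMap.sub_apply, LinearMap.sub_apply,
      sub_left_inj, sub_left_inj]
    ext X
    refine (Matrix.mulVec_diagonal _ _ X).trans ?_
    by_cases hj : Module.finrank F X = j
    · subst hj; rfl
    · simp [hx X hj]
  have h := (isLadder_rankPart F n).charpoly_eq hq.one_lt hL
  simp only [finrank_rankPart] at h
  rw [← Matrix.charpoly_toLin _ (PiLp.basisFun 2 ℝ (Submodule F (Fin n → F))),
    ← Matrix.toLpLin_eq_toLin]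
  exact h
end
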